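/- arXiv:2105.11736 — 2 statements merged into one kernel-verified Lean document; each statement's English description precedes it below -/
import Mathlib

section
/- Let φ ∈ Z^r_λ(C) be the character of an r-dimensional cycle (S, ∂̂, T̂, ρ) over a small ℂ-linear category C. Then S(φ) is a cyclic coboundary; explicitly S(φ) = bψ, where ψ ∈ CN^{r+1}(C) is given by ψ(f⁰⊗f¹⊗…⊗f^{r+1}) = Σ_{j=1}^{r+1} (−1)^{j−1} T̂(f⁰∂̂f¹⋯∂̂f^{j−1}·f^j·∂̂f^{j+1}⋯∂̂f^{r+1}) (writing f for ρ(f)). -/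
open scoped BigOperators TensorProduct

/-! ### Small `k`-linear (semi)categories -/

/-- A small `k`-linear semicategory: a "category possibly without identities"
whose Hom-sets are `k`-modules and whose composition is `k`-bilinear. -/
structure SemiCat (k : Type) [CommRing k] where
  Obj : Type
  Hom : Obj → Obj → Type
  acg : ∀ X Y, AddCommGroup (Hom X Y)
  mod : ∀ X Y, Module k (Hom X Y)
  comp : ∀ {X Y Z}, Hom Y Z → Hom X Y → Hom X Z
  comp_add_left : ∀ {X Y Z} (g g' : Hom Y Z) (f : Hom X Y),
    comp (g + g') f = comp g f + comp g' f
  comp_add_right : ∀ {X Y Z} (g : Hom Y Z) (f f' : Hom X Y),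
    comp g (f + f') = comp g f + comp g f'
  comp_smul_left : ∀ {X Y Z} (c : k) (g : Hom Y Z) (f : Hom X Y),
    comp (c • g) f = c • comp g f
  comp_smul_right : ∀ {X Y Z} (c : k) (g : Hom Y Z) (f : Hom X Y),
    comp g (c • f) = c • comp g f
  comp_assoc : ∀ {W X Y Z} (h : Hom Y Z) (g : Hom X Y) (f : Hom W X),
    comp (comp h g) f = comp h (comp g f)

attribute [instance] SemiCat.acg SemiCat.mod

/-- A small `k`-linear category (a `k`-linear semicategory with identities). -/
structure LinCat (k : Type) [CommRing k] extends SemiCat k where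
  id : ∀ X, Hom X X
  id_comp : ∀ {X Y} (f : Hom X Y), comp (id Y) f = f
  comp_id : ∀ {X Y} (f : Hom X Y), comp f (id X) = f

namespace SemiCat

variable {k : Type} [CommRing k] (D : SemiCat k)

/-- The type of morphisms of `D`, bundled with their domain and codomain. -/
def M : Type := Σ (A B : D.Obj), D.Hom A B

/-- Domain of a bundled morphism. -/
def dom (x : D.M) : D.Obj := x.1

/-- Codomain of a bundled morphism. -/
def cod (x : D.M) : D.Obj := x.2.1

open Classical in
/-- Composition of bundled morphisms `x ∘ y` (first `y`, then `x`); if the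
endpoints do not match, the zero morphism is returned. -/
noncomputable def sc (x y : D.M) : D.M :=
  if h : y.2.1 = x.1 then ⟨y.1, x.2.1, D.comp x.2.2 (cast (by rw [h]) y.2.2)⟩
  else ⟨y.1, x.2.1, 0⟩

/-- Replace the underlying morphism of a bundled morphism (same endpoints). -/
def setM (x : D.M) (f : D.Hom x.1 x.2.1) : D.M := ⟨x.1, x.2.1, f⟩

end SemiCat

namespace LinCat

variable {k : Type} [CommRing k] (D : LinCat k)

/-- The identity on `X` as a bundled morphism. -/
def idM (X : D.Obj) : D.toSemiCat.M := ⟨X, X, D.id X⟩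

/-! ### The cyclic nerve and cochains.

A degree `n` "cyclic tuple" on `D` is a tuple `(f⁰, f¹, …, fⁿ)` of bundled
morphisms; it is *cyclically composable* when `f i : X_{i+1} → X_i` with
indices mod `n+1`.  An `n`-cochain, i.e. an element of
`CN^n(D) = Hom_k(CN_n(D), k)`, is modelled as a function on all degree `n`
tuples which is `k`-multilinear in each slot and vanishes on tuples that are
not cyclically composable; such functions correspond exactly to linear
functionals on `CN_n(D) = ⊕ Hom(X₁,X₀) ⊗ ⋯ ⊗ Hom(X₀,Xₙ)`. -/

/-- Degree `n` tuples of bundled morphisms. -/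
def Tup (n : ℕ) : Type := Fin (n + 1) → D.toSemiCat.M

/-- Cyclic composability of a tuple: the domain of `f i` is the codomain of
`f (i+1)` (cyclically). -/
def IsCyc {n : ℕ} (F : D.Tup n) : Prop :=
  ∀ i : Fin (n + 1), (F i).2.1 = (F (i - 1)).1

/-- Update slot `i` of a tuple, keeping its endpoints. -/
def upd {n : ℕ} (F : D.Tup n) (i : Fin (n + 1)) (f : D.Hom (F i).1 (F i).2.1) :
    D.Tup n :=
  Function.update F i ⟨(F i).1, (F i).2.1, f⟩

/-- The predicate expressing that a function on degree `n` tuples is an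
`n`-cochain on the cyclic nerve of `D`, i.e. a linear functional on
`CN_n(D)`. -/
structure IsCochain {n : ℕ} (φ : D.Tup n → k) : Prop where
  map_add : ∀ (F : D.Tup n) (i : Fin (n + 1)) (f g : D.Hom (F i).1 (F i).2.1),
    φ (D.upd F i (f + g)) = φ (D.upd F i f) + φ (D.upd F i g)
  map_smul : ∀ (F : D.Tup n) (i : Fin (n + 1)) (c : k) (f : D.Hom (F i).1 (F i).2.1),
    φ (D.upd F i (c • f)) = c * φ (D.upd F i f)
  supported : ∀ F : D.Tup n, ¬ D.IsCyc F → φ F = 0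

/-! ### The cocyclic structure on `CN^•(D)` (trivial Hopf algebra case) -/

variable {n : ℕ}

/-- The cyclic rotation on tuples: `(f⁰,…,fⁿ) ↦ (fⁿ, f⁰, …, f^{n-1})`. -/
def rotT (F : D.Tup n) : D.Tup n :=
  fun j => if j = 0 then F (Fin.last n) else F (j - 1)

/-- The (unsigned) cyclic operator `τ_n` on cochains. -/
def tauOp (φ : D.Tup n → k) : D.Tup n → k := fun F => φ (D.rotT F)

/-- The signed cyclic operator `λ = (-1)ⁿ τ_n`. -/
def lamOp (φ : D.Tup n → k) : D.Tup n → k := fun F => (-1 : k) ^ n * D.tauOp φ F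

/-- The tuple obtained by composing the entries at slots `i` and `i+1`
(`0 ≤ i ≤ n`); used for the face maps `δ_0, …, δ_n`. -/
noncomputable def faceT (i : ℕ) (F : D.Tup (n + 1)) : D.Tup n := fun j =>
  if j.val < i then F ⟨j.val, by omega⟩
  else if j.val = i then
    D.toSemiCat.sc (F ⟨min i (n + 1), by omega⟩) (F ⟨min (i + 1) (n + 1), by omega⟩)
  else F ⟨j.val + 1, by omega⟩

/-- The tuple implementing the last face map
`(f⁰,…,f^{n+1}) ↦ ((f^{n+1} ∘ f⁰), f¹, …, fⁿ)`. -/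
noncomputable def lastFaceT (F : D.Tup (n + 1)) : D.Tup n := fun j =>
  if j = 0 then D.toSemiCat.sc (F (Fin.last (n + 1))) (F 0)
  else F ⟨j.val, by omega⟩

/-- The coface operators `δ_i : CN^n(D) → CN^{n+1}(D)`, `0 ≤ i ≤ n+1`. -/
noncomputable def deltaOp (i : Fin (n + 2)) (φ : D.Tup n → k) : D.Tup (n + 1) → k :=
  fun F => if i.val ≤ n then φ (D.faceT i.val F) else φ (D.lastFaceT F)

/-- The Hochschild coboundary `b = ∑ (-1)^i δ_i : CN^n(D) → CN^{n+1}(D)`. -/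
noncomputable def bOp (φ : D.Tup n → k) : D.Tup (n + 1) → k :=
  fun F => ∑ i : Fin (n + 2), (-1 : k) ^ (i : ℕ) * D.deltaOp i φ F

/-- The truncated coboundary `b' = ∑_{i=0}^{n} (-1)^i δ_i` (last face omitted). -/
noncomputable def bPrimeOp (φ : D.Tup n → k) : D.Tup (n + 1) → k :=
  fun F => ∑ i : Fin (n + 1), (-1 : k) ^ (i : ℕ) * D.deltaOp i.castSucc φ F

/-- The tuple inserting an identity after slot `i` (`0 ≤ i ≤ n`); for `i = n`
this inserts `id_{X₀}` at the end. -/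
noncomputable def degT (i : ℕ) (F : D.Tup n) : D.Tup (n + 1) := fun j =>
  if hj : j.val ≤ i ∧ j.val ≤ n then F ⟨j.val, by omega⟩
  else if j.val = i + 1 then D.idM ((F ⟨min i n, by omega⟩).1)
  else F ⟨j.val - 1, by omega⟩

/-- The codegeneracy operators `σ_i : CN^{n+1}(D) → CN^n(D)`, `0 ≤ i ≤ n`. -/
noncomputable def sigmaOp (i : Fin (n + 1)) (ψ : D.Tup (n + 1) → k) : D.Tup n → k :=
  fun F => ψ (D.degT i.val F)

/-- The norm operator `A = 1 + λ + λ² + ⋯ + λⁿ` on `CN^n(D)`. -/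
def AOp (φ : D.Tup n → k) : D.Tup n → k :=
  fun F => ∑ i ∈ Finset.range (n + 1), (D.lamOp)^[i] φ F

/-- The tuple `(id_{X₀}, f⁰, …, fⁿ)`. -/
def consIdT (F : D.Tup n) : D.Tup (n + 1) := fun j =>
  if j = 0 then D.idM ((F 0).2.1) else F ⟨j.val - 1, by omega⟩

/-- The tuple `(f⁰, …, fⁿ, id_{X₀})`. -/
def snocIdT (F : D.Tup n) : D.Tup (n + 1) := fun j =>
  if hj : j.val ≤ n then F ⟨j.val, by omega⟩ else D.idM ((F 0).2.1)

/-- The operator `B₀ : CN^{n+1}(D) → CN^n(D)`. -/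
def B0Op (ψ : D.Tup (n + 1) → k) : D.Tup n → k :=
  fun F => ψ (D.consIdT F) - (-1 : k) ^ (n + 1) * ψ (D.snocIdT F)

/-- Connes' operator `B = A ∘ B₀ : CN^{n+1}(D) → CN^n(D)`. -/
def BOp (ψ : D.Tup (n + 1) → k) : D.Tup n → k := D.AOp (D.B0Op ψ)

/-- Cyclic cochains: `C^n_λ(D) = Ker(1-λ)`. -/
def IsCyclicCochain (φ : D.Tup n → k) : Prop := D.IsCochain φ ∧ D.lamOp φ = φ

/-- Cyclic cocycles `Z^n_λ(D)`. -/
noncomputable def IsCocycle (φ : D.Tup n → k) : Prop :=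
  D.IsCochain φ ∧ D.lamOp φ = φ ∧ D.bOp φ = 0

/-- Cyclic coboundaries `B^{n+1}_λ(D)`: elements `b ψ` for a cyclic `n`-cochain `ψ`. -/
noncomputable def IsCoboundary (φ : D.Tup (n + 1) → k) : Prop :=
  ∃ ψ : D.Tup n → k, D.IsCochain ψ ∧ D.lamOp ψ = ψ ∧ D.bOp ψ = φ

end LinCat

/-! ### Differential graded semicategories, closed graded traces and cycles -/

/-- A (small) differential graded semicategory with object type `Obj`:
the Hom's are nonnegatively graded `k`-modules, composition is bilinear,
associative and additive in the degrees, and the differential `d` has degree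
`+1`, squares to zero and satisfies the graded Leibniz rule. -/
structure DGStr (k : Type) [CommRing k] (Obj : Type) where
  Hom : Obj → Obj → ℕ → Type
  acg : ∀ X Y n, AddCommGroup (Hom X Y n)
  mod : ∀ X Y n, Module k (Hom X Y n)
  /-- transport along an equality of degrees -/
  cst : ∀ {X Y : Obj} {m n : ℕ}, m = n → Hom X Y m → Hom X Y n
  cst_rfl : ∀ {X Y : Obj} {n : ℕ} (f : Hom X Y n), cst rfl f = f
  comp : ∀ {X Y Z : Obj} {i j : ℕ}, Hom Y Z i → Hom X Y j → Hom X Z (i + j)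
  comp_add_left : ∀ {X Y Z i j} (g g' : Hom Y Z i) (f : Hom X Y j),
    comp (g + g') f = comp g f + comp g' f
  comp_add_right : ∀ {X Y Z i j} (g : Hom Y Z i) (f f' : Hom X Y j),
    comp g (f + f') = comp g f + comp g f'
  comp_smul_left : ∀ {X Y Z i j} (c : k) (g : Hom Y Z i) (f : Hom X Y j),
    comp (c • g) f = c • comp g f
  comp_smul_right : ∀ {X Y Z i j} (c : k) (g : Hom Y Z i) (f : Hom X Y j),
    comp g (c • f) = c • comp g f
  comp_assoc : ∀ {W X Y Z} {i j l} (h : Hom Y Z i) (g : Hom X Y j) (f : Hom W X l),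
    comp h (comp g f) = cst (by omega) (comp (comp h g) f)
  d : ∀ {X Y : Obj} {n : ℕ}, Hom X Y n → Hom X Y (n + 1)
  d_add : ∀ {X Y n} (f g : Hom X Y n), d (f + g) = d f + d g
  d_smul : ∀ {X Y n} (c : k) (f : Hom X Y n), d (c • f) = c • d f
  d_sq : ∀ {X Y n} (f : Hom X Y n), d (d f) = 0
  leibniz : ∀ {X Y Z i j} (g : Hom Y Z i) (f : Hom X Y j),
    d (comp g f) = cst (by omega) (comp (d g) f) + (-1 : k) ^ i • comp g (d f)

attribute [instance] DGStr.acg DGStr.mod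

namespace DGStr

variable {k : Type} [CommRing k] {Obj : Type} (S : DGStr k Obj)

/-- Bundled (homogeneous) morphisms of a DG semicategory. -/
def M : Type := Σ (A B : Obj) (n : ℕ), S.Hom A B n

open Classical in
/-- Composition of bundled morphisms (zero morphism if endpoints mismatch). -/
noncomputable def sc (x y : S.M) : S.M :=
  if h : y.2.1 = x.1 then
    ⟨y.1, x.2.1, x.2.2.1 + y.2.2.1,
      S.comp x.2.2.2 (cast (congrArg (fun A => S.Hom y.1 A y.2.2.1) h) y.2.2.2)⟩
  else ⟨y.1, x.2.1, x.2.2.1 + y.2.2.1, 0⟩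

/-- The differential on bundled morphisms. -/
def dM (x : S.M) : S.M := ⟨x.1, x.2.1, x.2.2.1 + 1, S.d x.2.2.2⟩

/-- Left-to-right composition of a nonempty list of bundled morphisms. -/
noncomputable def prodM (x : S.M) (l : List S.M) : S.M := l.foldl S.sc x

end DGStr

/-- A closed graded trace of dimension `n` on a DG semicategory `S`
(trivial Hopf algebra, trivial coefficients). -/
structure GrTrace {k : Type} [CommRing k] {Obj : Type} (S : DGStr k Obj) (n : ℕ) where
  T : ∀ X : Obj, S.Hom X X n → k
  T_add : ∀ X (f g : S.Hom X X n), T X (f + g) = T X f + T X g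
  T_smul : ∀ X (c : k) (f : S.Hom X X n), T X (c • f) = c * T X f
  /-- `T(∂ f') = 0` for `f'` of degree `n - 1`. -/
  T_closed : ∀ (X : Obj) (m : ℕ) (hm : m + 1 = n) (f : S.Hom X X m),
    T X (S.cst hm (S.d f)) = 0
  /-- the graded trace property `T(g' g) = (-1)^{ij} T(g g')`. -/
  T_graded : ∀ (X Y : Obj) (i j : ℕ) (hij : i + j = n)
    (g : S.Hom X Y i) (g' : S.Hom Y X j),
    T X (S.cst (by omega) (S.comp g' g)) = (-1 : k) ^ (i * j) * T Y (S.cst hij (S.comp g g'))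

open Classical in
/-- Evaluation of a closed graded trace on a bundled endomorphism of correct
degree (and `0` otherwise). -/
noncomputable def GrTrace.ev {k : Type} [CommRing k] {Obj : Type} {S : DGStr k Obj}
    {n : ℕ} (Tr : GrTrace S n) (x : S.M) : k :=
  if h : x.1 = x.2.1 ∧ x.2.2.1 = n then
    Tr.T x.1 (cast (by
      rw [show S.Hom x.1 x.2.1 x.2.2.1 = S.Hom x.1 x.1 x.2.2.1 from
        congrArg (fun A => S.Hom x.1 A x.2.2.1) h.1.symm]
      exact congrArg (S.Hom x.1 x.1) h.2) x.2.2.2 : S.Hom x.1 x.1 n)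
  else 0

/-- A `k`-linear semifunctor from a semicategory `C` into the degree `0` part
of a DG semicategory `S`. -/
structure SemiFun0 {k : Type} [CommRing k] (C : SemiCat k) {Obj' : Type}
    (S : DGStr k Obj') where
  obj : C.Obj → Obj'
  map : ∀ {X Y : C.Obj}, C.Hom X Y → S.Hom (obj X) (obj Y) 0
  map_add : ∀ {X Y} (f g : C.Hom X Y), map (f + g) = map f + map g
  map_smul : ∀ {X Y} (c : k) (f : C.Hom X Y), map (c • f) = c • map f
  map_comp : ∀ {X Y Z} (g : C.Hom Y Z) (f : C.Hom X Y),
    map (C.comp g f) = S.comp (map g) (map f)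

namespace SemiFun0

variable {k : Type} [CommRing k] {C : SemiCat k} {Obj' : Type} {S : DGStr k Obj'}

/-- Image of a bundled morphism. -/
def sig (ρ : SemiFun0 C S) (x : C.M) : S.M := ⟨ρ.obj x.1, ρ.obj x.2.1, 0, ρ.map x.2.2⟩

end SemiFun0

/-- The character of the `n`-dimensional cycle `(S, d, Tr, ρ)` over the
category `D`, as a function on degree `n` tuples:
`(f⁰,…,fⁿ) ↦ Tr(ρ(f⁰) ∂(ρ f¹) ⋯ ∂(ρ fⁿ))`. -/
noncomputable def cycleChar {k : Type} [CommRing k] (D : LinCat k) {Obj' : Type}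
    {S : DGStr k Obj'} {n : ℕ} (Tr : GrTrace S n) (ρ : SemiFun0 D.toSemiCat S) :
    D.Tup n → k :=
  fun F => Tr.ev (S.prodM (ρ.sig (F 0))
    (((List.finRange n).map fun l => S.dM (ρ.sig (F ⟨l.val + 1, by omega⟩)))))

/-- `φ` is the character of the given `n`-dimensional cycle over `D` (they agree
on cyclically composable tuples, which determine the corresponding functionals
on the cyclic nerve). -/
noncomputable def IsCharOf {k : Type} [CommRing k] (D : LinCat k) {Obj' : Type}
    {n : ℕ} (S : DGStr k Obj') (Tr : GrTrace S n) (ρ : SemiFun0 D.toSemiCat S)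
    (φ : D.Tup n → k) : Prop :=
  ∀ F : D.Tup n, D.IsCyc F → φ F = cycleChar D Tr ρ F

section SOperator

variable {k : Type} [CommRing k] (D : LinCat k) {Obj' : Type} {S : DGStr k Obj'}

/-- The `j`-th term of the image of the periodicity operator applied to the
character of an `r`-dimensional cycle `(S, Tr, ρ)`:
`T̂(ρf⁰ ∂ρf¹ ⋯ ∂ρf^{j-1} (ρf^j ρf^{j+1}) ∂ρf^{j+2} ⋯ ∂ρf^{r+2})`. -/
noncomputable def sCharTerm {r : ℕ} (Tr : GrTrace S r) (ρ : SemiFun0 D.toSemiCat S)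
    (j : ℕ) (F : D.Tup (r + 2)) : k :=
  Tr.ev (S.prodM (ρ.sig (F 0)) ((List.finRange (r + 2)).filterMap fun l =>
    if l.val + 1 = j + 1 then none
    else if l.val + 1 = j then
      some (S.sc (ρ.sig (F ⟨min j (r + 1), by omega⟩))
        (ρ.sig (F ⟨min (j + 1) (r + 2), by omega⟩)))
    else some (S.dM (ρ.sig (F ⟨l.val + 1, by omega⟩)))))

/-- The image `S(φ)` of the character `φ` of the `r`-dimensional cycle
`(S, Tr, ρ)` under the periodicity operator (Lemma `Sform`):
`(Sφ)(f⁰ ⊗ … ⊗ f^{r+2}) = ∑_{j=1}^{r+1} T̂(ρf⁰ ∂ρf¹ ⋯ (ρf^j ρf^{j+1}) ⋯ ∂ρf^{r+2})`. -/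
noncomputable def sCharOp {r : ℕ} (Tr : GrTrace S r) (ρ : SemiFun0 D.toSemiCat S)
    (F : D.Tup (r + 2)) : k :=
  ∑ j ∈ Finset.Icc 1 (r + 1), sCharTerm D Tr ρ j F

/-- The cochain `ψ(f⁰ ⊗ … ⊗ f^{r+1}) = ∑_{j=1}^{r+1} (-1)^{j-1}
T̂(ρf⁰ ∂ρf¹ ⋯ ∂ρf^{j-1} · ρf^j · ∂ρf^{j+1} ⋯ ∂ρf^{r+1})`. -/
noncomputable def sPsi {r : ℕ} (Tr : GrTrace S r) (ρ : SemiFun0 D.toSemiCat S)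
    (F : D.Tup (r + 1)) : k :=
  ∑ j ∈ Finset.Icc 1 (r + 1), (-1 : k) ^ (j - 1) *
    Tr.ev (S.prodM (ρ.sig (F 0)) ((List.finRange (r + 1)).map fun l =>
      if l.val + 1 = j then ρ.sig (F ⟨l.val + 1, by omega⟩)
      else S.dM (ρ.sig (F ⟨l.val + 1, by omega⟩))))

end SOperator

namespace DGStr

variable {k : Type} [CommRing k] {Obj : Type} (S : DGStr k Obj)

open Classical in
/-- Sum of two bundled morphisms with the same endpoints and degree
(junk otherwise). -/
noncomputable def saddM (x y : S.M) : S.M :=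
  if h : y.1 = x.1 ∧ y.2.1 = x.2.1 ∧ y.2.2.1 = x.2.2.1 then
    ⟨x.1, x.2.1, x.2.2.1, x.2.2.2 + cast
      (((congrArg (fun A => S.Hom A y.2.1 y.2.2.1) h.1).trans
        (congrArg (fun B => S.Hom x.1 B y.2.2.1) h.2.1)).trans
        (congrArg (S.Hom x.1 x.2.1) h.2.2)) y.2.2.2⟩
  else x

/-- Scalar multiple of a bundled morphism. -/
def smulM (c : k) (x : S.M) : S.M := ⟨x.1, x.2.1, x.2.2.1, c • x.2.2.2⟩

end DGStr

namespace DGStr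

variable {k : Type} [CommRing k] {Obj : Type} (S : DGStr k Obj)

theorem comp_zero_right {X Y Z : Obj} {i j : ℕ} (g : S.Hom Y Z i) :
    S.comp g (0 : S.Hom X Y j) = 0 := by
  have h := S.comp_smul_right (0 : k) g (0 : S.Hom X Y j)
  rwa [zero_smul, zero_smul] at h

theorem comp_zero_left {X Y Z : Obj} {i j : ℕ} (f : S.Hom X Y j) :
    S.comp (0 : S.Hom Y Z i) f = 0 := by
  have h := S.comp_smul_left (0 : k) (0 : S.Hom Y Z i) f
  rwa [zero_smul, zero_smul] at h

theorem d_zero {X Y : Obj} {n : ℕ} : S.d (0 : S.Hom X Y n) = 0 := by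
  have h := S.d_smul (0 : k) (0 : S.Hom X Y n)
  rwa [zero_smul, zero_smul] at h

/-- Bundling a homogeneous morphism. -/
abbrev mkM (X Y : Obj) (n : ℕ) (f : S.Hom X Y n) : S.M := ⟨X, Y, n, f⟩

theorem mkM_cst {X Y : Obj} {m n : ℕ} (h : m = n) (f : S.Hom X Y m) :
    S.mkM X Y n (S.cst h f) = S.mkM X Y m f := by
  subst h
  rw [S.cst_rfl]

theorem mkM_zero_congr {X Y : Obj} {m n : ℕ} (h : m = n) :
    S.mkM X Y m 0 = S.mkM X Y n 0 := by
  subst h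
  rfl

theorem sc_mkM {X Y Z : Obj} {i j : ℕ} (g : S.Hom Y Z i) (f : S.Hom X Y j) :
    S.sc (S.mkM Y Z i g) (S.mkM X Y j f) = S.mkM X Z (i + j) (S.comp g f) := by
  simp [sc]
  rfl

theorem sc_mkM_of_ne {W X Y Z : Obj} {i j : ℕ} (h : X ≠ Y)
    (g : S.Hom Y Z i) (f : S.Hom W X j) :
    S.sc (S.mkM Y Z i g) (S.mkM W X j f) = S.mkM W Z (i + j) 0 := by
  simp [sc, h]
  rfl

theorem sc_assoc (x y z : S.M) : S.sc (S.sc x y) z = S.sc x (S.sc y z) := by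
  obtain ⟨A, B, i, f⟩ := x
  obtain ⟨A', B', j, g⟩ := y
  obtain ⟨A'', B'', l, h⟩ := z
  change S.sc (S.sc (S.mkM A B i f) (S.mkM A' B' j g)) (S.mkM A'' B'' l h) =
    S.sc (S.mkM A B i f) (S.sc (S.mkM A' B' j g) (S.mkM A'' B'' l h))
  by_cases h₁ : B' = A
  · subst h₁
    by_cases h₂ : B'' = A'
    · subst h₂
      simp only [sc_mkM]
      rw [S.comp_assoc, mkM_cst]
    · rw [sc_mkM, sc_mkM_of_ne _ h₂, sc_mkM_of_ne _ h₂, sc_mkM, comp_zero_right]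
      exact S.mkM_zero_congr (by omega)
  · by_cases h₂ : B'' = A'
    · subst h₂
      rw [sc_mkM, sc_mkM_of_ne _ h₁, sc_mkM_of_ne _ h₁, sc_mkM, comp_zero_left]
      exact S.mkM_zero_congr (by omega)
    · rw [sc_mkM_of_ne _ h₁, sc_mkM_of_ne _ h₂, sc_mkM_of_ne _ h₂, sc_mkM_of_ne _ h₁]
      exact S.mkM_zero_congr (by omega)

/-- `z` is the sum of the parallel homogeneous morphisms `x` and `y`. -/
def IsSum (z x y : S.M) : Prop :=
  ∃ (A B : Obj) (n : ℕ) (f g : S.Hom A B n),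
    z = S.mkM A B n (f + g) ∧ x = S.mkM A B n f ∧ y = S.mkM A B n g

variable {S}

theorem IsSum.sc_right {z x y : S.M} (h : S.IsSum z x y) (w : S.M) :
    S.IsSum (S.sc z w) (S.sc x w) (S.sc y w) := by
  obtain ⟨A, B, n, f, g, rfl, rfl, rfl⟩ := h
  obtain ⟨A', B', j, u⟩ := w
  by_cases e : B' = A
  · subst e
    refine ⟨A', B, n + j, S.comp f u, S.comp g u, ?_, S.sc_mkM _ _, S.sc_mkM _ _⟩
    rw [← S.comp_add_left]
    exact S.sc_mkM _ _
  · refine ⟨A', B, n + j, 0, 0, ?_, S.sc_mkM_of_ne e _ _, S.sc_mkM_of_ne e _ _⟩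
    rw [add_zero]
    exact S.sc_mkM_of_ne e _ _

theorem IsSum.sc_left {z x y : S.M} (h : S.IsSum z x y) (w : S.M) :
    S.IsSum (S.sc w z) (S.sc w x) (S.sc w y) := by
  obtain ⟨A, B, n, f, g, rfl, rfl, rfl⟩ := h
  obtain ⟨A', B', j, u⟩ := w
  by_cases e : B = A'
  · subst e
    refine ⟨A, B', j + n, S.comp u f, S.comp u g, ?_, S.sc_mkM _ _, S.sc_mkM _ _⟩
    rw [← S.comp_add_right]
    exact S.sc_mkM _ _
  · refine ⟨A, B', j + n, 0, 0, ?_, S.sc_mkM_of_ne e _ _, S.sc_mkM_of_ne e _ _⟩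
    rw [add_zero]
    exact S.sc_mkM_of_ne e _ _

theorem isSum_dM_sc (x y : S.M) (hx : x.2.2.1 = 0) :
    S.IsSum (S.dM (S.sc x y)) (S.sc (S.dM x) y) (S.sc x (S.dM y)) := by
  obtain ⟨A, B, i, f⟩ := x
  obtain ⟨A', B', j, g⟩ := y
  obtain rfl : i = 0 := hx
  change S.IsSum (S.dM (S.sc (S.mkM A B 0 f) (S.mkM A' B' j g)))
    (S.sc (S.mkM A B (0 + 1) (S.d f)) (S.mkM A' B' j g))
    (S.sc (S.mkM A B 0 f) (S.mkM A' B' (j + 1) (S.d g)))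
  by_cases e : B' = A
  · subst e
    simp only [sc_mkM]
    refine ⟨A', B, 0 + j + 1, _, _, ?_, (S.mkM_cst (by omega) _).symm, rfl⟩
    change S.mkM _ _ _ _ = _
    rw [S.leibniz, pow_zero, one_smul]
  · simp only [sc_mkM_of_ne _ e]
    refine ⟨A', B, 0 + j + 1, 0, 0, ?_, S.mkM_zero_congr (by omega), rfl⟩
    change S.mkM _ _ _ _ = _
    rw [S.d_zero, add_zero]

variable (S)

/-- The product `a 0 · a 1 ⋯ a n`. -/
noncomputable def seqProd (a : ℕ → S.M) : ℕ → S.M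
  | 0 => a 0
  | n + 1 => S.sc (seqProd a n) (a (n + 1))

theorem seqProd_congr {a b : ℕ → S.M} (n : ℕ) (h : ∀ l ≤ n, a l = b l) :
    S.seqProd a n = S.seqProd b n := by
  induction n with
  | zero => exact h 0 le_rfl
  | succ n ih =>
    rw [seqProd, seqProd, ih fun l hl => h l (by omega), h (n + 1) le_rfl]

theorem isSum_seqProd {a b c : ℕ → S.M} {i n : ℕ} (hin : i ≤ n)
    (hi : S.IsSum (c i) (a i) (b i)) (ha : ∀ l ≤ n, l ≠ i → a l = c l)
    (hb : ∀ l ≤ n, l ≠ i → b l = c l) :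
    S.IsSum (S.seqProd c n) (S.seqProd a n) (S.seqProd b n) := by
  induction n with
  | zero =>
    obtain rfl : i = 0 := by omega
    exact hi
  | succ n ih =>
    rcases Nat.lt_or_ge n i with h | h
    · obtain rfl : i = n + 1 := by omega
      rw [seqProd, seqProd, seqProd,
        S.seqProd_congr n fun l hl => ha l (by omega) (by omega),
        S.seqProd_congr n fun l hl => hb l (by omega) (by omega)]
      exact hi.sc_left _
    · rw [seqProd, seqProd, seqProd, ha (n + 1) le_rfl (by omega),
        hb (n + 1) le_rfl (by omega)]
      exact (ih h (fun l hl => ha l (by omega)) fun l hl => hb l (by omega)).sc_right _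

theorem seqProd_contract {a c : ℕ → S.M} {i n : ℕ} (hin : i ≤ n)
    (hlt : ∀ l < i, c l = a l) (hi : c i = S.sc (a i) (a (i + 1)))
    (hgt : ∀ l, i < l → l ≤ n → c l = a (l + 1)) :
    S.seqProd c n = S.seqProd a (n + 1) := by
  induction n with
  | zero =>
    obtain rfl : i = 0 := by omega
    exact hi
  | succ n ih =>
    rcases Nat.lt_or_ge n i with h | h
    · obtain rfl : i = n + 1 := by omega
      rw [seqProd, seqProd, seqProd, hi, sc_assoc,
        S.seqProd_congr n fun l hl => hlt l (by omega)]
    · rw [seqProd, ih h fun l h₁ h₂ => hgt l h₁ (by omega), hgt (n + 1) (by omega) le_rfl]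
      rfl

theorem seqProd_sc_head {a c : ℕ → S.M} (x : S.M) (n : ℕ) (h₀ : c 0 = S.sc x (a 0))
    (h : ∀ l, 0 < l → l ≤ n → c l = a l) :
    S.seqProd c n = S.sc x (S.seqProd a n) := by
  induction n with
  | zero => exact h₀
  | succ n ih =>
    rw [seqProd, seqProd, ih fun l h₁ h₂ => h l h₁ (by omega), h (n + 1) (by omega) le_rfl,
      sc_assoc]

theorem prodM_map_range (a : ℕ → S.M) (n : ℕ) :
    S.prodM (a 0) ((List.range n).map fun l => a (l + 1)) = S.seqProd a n := by
  induction n with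
  | zero => rfl
  | succ n ih =>
    rw [prodM] at ih
    rw [prodM, List.range_succ, List.map_append, List.foldl_append, ih]
    rfl

theorem prodM_filterMap_range (a : ℕ → S.M) (h : ℕ → Option S.M) {j : ℕ} (hj : 1 ≤ j)
    (h_skip : h j = none) (h_sc : h (j - 1) = some (S.sc (a j) (a (j + 1))))
    (h_else : ∀ l, l ≠ j → l ≠ j - 1 → h l = some (a (l + 1))) {n : ℕ} (hn : j < n) :
    S.prodM (a 0) ((List.range n).filterMap h) = S.seqProd a n := by
  have below : ∀ m < j, S.prodM (a 0) ((List.range m).filterMap h) = S.seqProd a m := by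
    intro m
    induction m with
    | zero => exact fun _ => rfl
    | succ m ih =>
      intro hm
      have ih := ih (by omega)
      rw [prodM] at ih
      rw [prodM, List.range_succ, List.filterMap_append, List.foldl_append, ih]
      simp [h_else m (by omega) (by omega), seqProd]
  induction n with
  | zero => omega
  | succ n ih =>
    rcases Nat.lt_or_ge j n with hjn | hjn
    · have ih := ih hjn
      rw [prodM] at ih
      rw [prodM, List.range_succ, List.filterMap_append, List.foldl_append, ih]
      simp [h_else n (by omega) (by omega), seqProd]
    · obtain rfl : j = n := by omega
      obtain ⟨m, rfl⟩ : ∃ m, j = m + 1 := ⟨j - 1, by omega⟩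
      have hb := below m (by omega)
      rw [prodM] at hb
      rw [Nat.add_sub_cancel] at h_sc
      rw [prodM, List.range_succ, List.range_succ, List.filterMap_append,
        List.filterMap_append, List.foldl_append, List.foldl_append, hb]
      simp [h_skip, h_sc, seqProd, sc_assoc]

end DGStr

namespace GrTrace

variable {k : Type} [CommRing k] {Obj : Type} {S : DGStr k Obj} {r : ℕ} (Tr : GrTrace S r)

theorem ev_mkM {X : Obj} {m : ℕ} (h : m = r) (f : S.Hom X X m) :
    Tr.ev (S.mkM X X m f) = Tr.T X (S.cst h f) := by
  subst h
  simp [ev, S.cst_rfl]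

theorem ev_of_ne {X Y : Obj} {m : ℕ} (h : X ≠ Y) (f : S.Hom X Y m) :
    Tr.ev (S.mkM X Y m f) = 0 := by
  simp [ev, h]

theorem ev_of_deg_ne {X Y : Obj} {m : ℕ} (h : m ≠ r) (f : S.Hom X Y m) :
    Tr.ev (S.mkM X Y m f) = 0 := by
  simp [ev, h]

theorem ev_zero {X Y : Obj} {m : ℕ} : Tr.ev (S.mkM X Y m 0) = 0 := by
  by_cases h : X = Y
  · subst h
    by_cases hm : m = r
    · subst hm
      rw [Tr.ev_mkM rfl, S.cst_rfl]
      have h := Tr.T_smul X 0 0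
      rwa [zero_smul, zero_mul] at h
    · exact Tr.ev_of_deg_ne hm _
  · exact Tr.ev_of_ne h _

theorem ev_isSum {z x y : S.M} (h : S.IsSum z x y) : Tr.ev z = Tr.ev x + Tr.ev y := by
  obtain ⟨A, B, n, f, g, rfl, rfl, rfl⟩ := h
  by_cases h : A = B
  · subst h
    by_cases hm : n = r
    · subst hm
      simp only [Tr.ev_mkM rfl, S.cst_rfl, Tr.T_add]
    · simp only [Tr.ev_of_deg_ne hm, add_zero]
  · simp only [Tr.ev_of_ne h, add_zero]

/-- A closed graded trace is symmetric when one of the factors has degree zero. -/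
theorem ev_sc_comm (x y : S.M) (hx : x.2.2.1 = 0) : Tr.ev (S.sc x y) = Tr.ev (S.sc y x) := by
  obtain ⟨A, B, i, f⟩ := x
  obtain ⟨A', B', j, g⟩ := y
  obtain rfl : i = 0 := hx
  change Tr.ev (S.sc (S.mkM A B 0 f) (S.mkM A' B' j g)) =
    Tr.ev (S.sc (S.mkM A' B' j g) (S.mkM A B 0 f))
  by_cases h₁ : B' = A
  · subst h₁
    by_cases h₂ : B = A'
    · subst h₂
      rw [S.sc_mkM, S.sc_mkM]
      by_cases hj : j = r
      · have h := Tr.T_graded B B' j 0 (by omega) g f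
        rw [mul_zero, pow_zero, one_mul] at h
        rw [Tr.ev_mkM (by omega), Tr.ev_mkM (by omega)]
        exact h
      · rw [Tr.ev_of_deg_ne (by omega), Tr.ev_of_deg_ne (by omega)]
    · rw [S.sc_mkM, S.sc_mkM_of_ne h₂, ev_zero, Tr.ev_of_ne (Ne.symm h₂)]
  · by_cases h₂ : B = A'
    · subst h₂
      rw [S.sc_mkM, S.sc_mkM_of_ne h₁, ev_zero, Tr.ev_of_ne (Ne.symm h₁)]
    · rw [S.sc_mkM_of_ne h₁, S.sc_mkM_of_ne h₂, ev_zero, ev_zero]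

end GrTrace

theorem SemiFun0.sig_sc {k : Type} [CommRing k] {C : SemiCat k} {Obj' : Type}
    {S : DGStr k Obj'} (ρ : SemiFun0 C S) (x y : C.M) (h : y.2.1 = x.1) :
    ρ.sig (C.sc x y) = S.sc (ρ.sig x) (ρ.sig y) := by
  obtain ⟨A, B, f⟩ := x
  obtain ⟨A', B', g⟩ := y
  obtain rfl : B' = A := h
  have h : C.sc ⟨B', B, f⟩ ⟨A', B', g⟩ = ⟨A', B, C.comp f g⟩ := dif_pos rfl
  rw [h]
  refine Eq.trans ?_ (S.sc_mkM (ρ.map f) (ρ.map g)).symm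
  rw [← ρ.map_comp]
  rfl

section Coboundary

variable {k : Type} [CommRing k] (D : LinCat k) {Obj' : Type} {S : DGStr k Obj'}

/-- The images of the entries of a tuple, as a sequence (constant after the last entry). -/
def imgSeq (ρ : SemiFun0 D.toSemiCat S) {n : ℕ} (F : D.Tup n) (l : ℕ) : S.M :=
  ρ.sig (F ⟨min l n, by omega⟩)

/-- The sequence `s 0, ∂(s 1), ∂(s 2), …`, with `s p` and `s q` left undifferentiated. -/
def diffSeq (s : ℕ → S.M) (p q l : ℕ) : S.M :=
  if l = 0 ∨ l = p ∨ l = q then s l else S.dM (s l)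

theorem imgSeq_of_le (ρ : SemiFun0 D.toSemiCat S) {n : ℕ} (F : D.Tup n) {l : ℕ} (h : l ≤ n) :
    imgSeq D ρ F l = ρ.sig (F ⟨l, by omega⟩) := by
  simp only [imgSeq, min_eq_left h]

theorem LinCat.IsCyc.cod_eq_dom {D : LinCat k} {n : ℕ} {F : D.Tup (n + 1)} (hF : D.IsCyc F)
    {i : ℕ} (hi : i ≤ n) : (F ⟨i + 1, by omega⟩).2.1 = (F ⟨i, by omega⟩).1 := by
  have h := hF ⟨i + 1, by omega⟩
  have e : (⟨i + 1, by omega⟩ : Fin (n + 2)) - 1 = ⟨i, by omega⟩ := by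
    rw [sub_eq_iff_eq_add]
    ext
    simp [Fin.val_add, Nat.mod_eq_of_lt (show i + 1 < n + 2 by omega)]
  rwa [e] at h

theorem LinCat.IsCyc.cod_zero_eq_dom_last {D : LinCat k} {n : ℕ} {F : D.Tup (n + 1)}
    (hF : D.IsCyc F) : (F 0).2.1 = (F (Fin.last (n + 1))).1 := by
  have h := hF 0
  have e : (0 : Fin (n + 2)) - 1 = Fin.last (n + 1) := by
    rw [sub_eq_iff_eq_add]
    simp
  rwa [e] at h

variable (ρ : SemiFun0 D.toSemiCat S) {n : ℕ}

theorem imgSeq_faceT_of_lt (F : D.Tup (n + 1)) {i l : ℕ} (hl : l < i) (hi : i ≤ n) :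
    imgSeq D ρ (D.faceT i F) l = imgSeq D ρ F l := by
  rw [imgSeq_of_le D ρ _ (by omega), imgSeq_of_le D ρ _ (by omega)]
  simp [LinCat.faceT, hl]

theorem imgSeq_faceT_self {F : D.Tup (n + 1)} (hF : D.IsCyc F) {i : ℕ} (hi : i ≤ n) :
    imgSeq D ρ (D.faceT i F) i = S.sc (imgSeq D ρ F i) (imgSeq D ρ F (i + 1)) := by
  rw [imgSeq_of_le D ρ _ hi, imgSeq_of_le D ρ _ (by omega), imgSeq_of_le D ρ _ (by omega),
    ← ρ.sig_sc _ _ (hF.cod_eq_dom hi)]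
  simp [LinCat.faceT, min_eq_left (show i ≤ n + 1 by omega), hi]

theorem imgSeq_faceT_of_gt (F : D.Tup (n + 1)) {i l : ℕ} (hl : i < l) (hn : l ≤ n) :
    imgSeq D ρ (D.faceT i F) l = imgSeq D ρ F (l + 1) := by
  rw [imgSeq_of_le D ρ _ hn, imgSeq_of_le D ρ _ (by omega)]
  simp [LinCat.faceT, show ¬ l < i by omega, show l ≠ i by omega]

theorem imgSeq_lastFaceT_zero {F : D.Tup (n + 1)} (hF : D.IsCyc F) :
    imgSeq D ρ (D.lastFaceT F) 0 = S.sc (imgSeq D ρ F (n + 1)) (imgSeq D ρ F 0) := by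
  rw [imgSeq_of_le D ρ _ (by omega), imgSeq_of_le D ρ _ (by omega),
    imgSeq_of_le D ρ _ (by omega)]
  exact ρ.sig_sc _ _ hF.cod_zero_eq_dom_last

theorem imgSeq_lastFaceT_of_pos (F : D.Tup (n + 1)) {l : ℕ} (hl : 0 < l) (hn : l ≤ n) :
    imgSeq D ρ (D.lastFaceT F) l = imgSeq D ρ F l := by
  rw [imgSeq_of_le D ρ _ hn, imgSeq_of_le D ρ _ (by omega)]
  have h : (⟨l, by omega⟩ : Fin (n + 1)) ≠ 0 := by
    intro h
    have := congrArg Fin.val h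
    simp at this
    omega
  simp [LinCat.lastFaceT, h]

theorem list_finRange_map_val {α : Type*} (n : ℕ) (f : ℕ → α) :
    (List.finRange n).map (fun l => f l.val) = (List.range n).map f := by
  rw [← List.map_coe_finRange_eq_range, List.map_map]
  rfl

theorem list_finRange_filterMap_val {α : Type*} (n : ℕ) (f : ℕ → Option α) :
    (List.finRange n).filterMap (fun l => f l.val) = (List.range n).filterMap f := by
  rw [← List.map_coe_finRange_eq_range, List.filterMap_map]
  rfl

variable {r : ℕ} (Tr : GrTrace S r)

/-- The trace of `f⁰ ∂f¹ ⋯ ∂fⁿ` with `fᵖ` and `f^q` left undifferentiated. -/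
noncomputable def diffTrace (F : D.Tup n) (p q : ℕ) : k :=
  Tr.ev (S.seqProd (diffSeq (imgSeq D ρ F) p q) n)

theorem sPsi_eq_sum_diffTrace (F : D.Tup (r + 1)) :
    sPsi D Tr ρ F =
      ∑ j ∈ Finset.Icc 1 (r + 1), (-1 : k) ^ (j - 1) * diffTrace D ρ Tr F j j := by
  refine Finset.sum_congr rfl fun j _ => ?_
  rw [diffTrace, ← S.prodM_map_range, ← list_finRange_map_val]
  congr 3
  refine List.map_congr_left fun l _ => ?_
  simp only [diffSeq, or_self, Nat.add_eq_zero_iff, one_ne_zero, and_false, false_or]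
  rw [imgSeq_of_le D ρ F (by omega)]

theorem sCharTerm_eq_diffTrace (F : D.Tup (r + 2)) {j : ℕ} (hj : 1 ≤ j) (hjr : j ≤ r + 1) :
    sCharTerm D Tr ρ j F = diffTrace D ρ Tr F j (j + 1) := by
  rw [diffTrace, ← S.prodM_filterMap_range _ (fun l : ℕ => if l + 1 = j + 1 then none
      else if l + 1 = j then some (S.sc (imgSeq D ρ F j) (imgSeq D ρ F (j + 1)))
      else some (S.dM (imgSeq D ρ F (l + 1)))) hj (by simp) ?_ ?_ (by omega),
    ← list_finRange_filterMap_val]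
  · rw [sCharTerm]
    congr 2
    refine List.filterMap_congr fun l _ => ?_
    rw [imgSeq_of_le D ρ F (show l.val + 1 ≤ r + 2 by omega),
      imgSeq_of_le D ρ F (show j ≤ r + 2 by omega),
      imgSeq_of_le D ρ F (show j + 1 ≤ r + 2 by omega)]
    simp only [min_eq_left hjr, min_eq_left (show j + 1 ≤ r + 2 by omega)]
  · simp [diffSeq, show j - 1 + 1 = j by omega]
  · intro l h₁ h₂
    simp [diffSeq, h₁, show l + 1 ≠ j by omega]

variable {D}

theorem diffTrace_comm (F : D.Tup n) (p q : ℕ) :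
    diffTrace D ρ Tr F p q = diffTrace D ρ Tr F q p := by
  rw [diffTrace, diffTrace]
  congr 2
  funext l
  simp only [diffSeq, or_comm]

theorem diffTrace_faceT_zero {F : D.Tup (n + 1)} (hF : D.IsCyc F) {j : ℕ} :
    diffTrace D ρ Tr (D.faceT 0 F) j j = diffTrace D ρ Tr F 1 (j + 1) := by
  rw [diffTrace, diffTrace, S.seqProd_contract (i := 0) (by omega)
    (a := diffSeq (imgSeq D ρ F) 1 (j + 1)) (by simp)]
  · simp [diffSeq, imgSeq_faceT_self D ρ hF]
  · intro l h₁ h₂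
    simp only [diffSeq, imgSeq_faceT_of_gt D ρ F h₁ h₂]
    grind

theorem diffTrace_faceT_self {F : D.Tup (n + 1)} (hF : D.IsCyc F) {j : ℕ} (hjn : j ≤ n) :
    diffTrace D ρ Tr (D.faceT j F) j j = diffTrace D ρ Tr F j (j + 1) := by
  rw [diffTrace, diffTrace, S.seqProd_contract (i := j) hjn
    (a := diffSeq (imgSeq D ρ F) j (j + 1))]
  · intro l h
    simp only [diffSeq, imgSeq_faceT_of_lt D ρ F h hjn]
    grind
  · simp [diffSeq, imgSeq_faceT_self D ρ hF hjn]
  · intro l h₁ h₂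
    simp only [diffSeq, imgSeq_faceT_of_gt D ρ F h₁ h₂]
    grind

/-- The Leibniz rule at a differentiated slot; `j'` is the position, before
composing slots `i` and `i + 1`, of the undifferentiated slot `j`. -/
theorem diffTrace_faceT_leibniz {F : D.Tup (n + 1)} (hF : D.IsCyc F) {i j j' : ℕ}
    (hi : 1 ≤ i) (hin : i ≤ n) (hj : i < j ∧ j' = j + 1 ∨ j < i ∧ j' = j) :
    diffTrace D ρ Tr (D.faceT i F) j j =
      diffTrace D ρ Tr F i j' + diffTrace D ρ Tr F (i + 1) j' := by
  set s := imgSeq D ρ F with hs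
  let c := diffSeq (imgSeq D ρ (D.faceT i F)) j j
  have h := S.isSum_seqProd (c := c) (i := i) (n := n)
    (a := Function.update c i (S.sc (S.dM (s i)) (s (i + 1))))
    (b := Function.update c i (S.sc (s i) (S.dM (s (i + 1))))) hin
    (by
      rw [Function.update_self, Function.update_self]
      have hc : c i = S.dM (S.sc (s i) (s (i + 1))) := by
        simp only [c, diffSeq, imgSeq_faceT_self D ρ hF hin]
        grind
      rw [hc]
      exact DGStr.isSum_dM_sc _ _ rfl)
    (fun l _ h => Function.update_of_ne h _ _) (fun l _ h => Function.update_of_ne h _ _)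
  have key (x : S.M) (p : ℕ) (hp : p = i ∨ p = i + 1)
      (hx : x = S.sc (diffSeq s p j' i) (diffSeq s p j' (i + 1))) :
      S.seqProd (Function.update c i x) n = S.seqProd (diffSeq s p j') (n + 1) := by
    refine S.seqProd_contract hin ?_ ?_ ?_
    · intro l hl
      rw [Function.update_of_ne hl.ne]
      simp only [c, diffSeq, imgSeq_faceT_of_lt D ρ F hl hin]
      grind
    · rw [Function.update_self, hx]
    · intro l h₁ h₂
      rw [Function.update_of_ne h₁.ne']
      simp only [c, diffSeq, imgSeq_faceT_of_gt D ρ F h₁ h₂]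
      grind
  rw [key _ (i + 1) (Or.inr rfl) (by simp only [diffSeq]; grind),
    key _ i (Or.inl rfl) (by simp only [diffSeq]; grind)] at h
  rw [add_comm]
  exact Tr.ev_isSum h

theorem diffTrace_lastFaceT {F : D.Tup (n + 1)} (hF : D.IsCyc F) {j : ℕ} :
    diffTrace D ρ Tr (D.lastFaceT F) j j = diffTrace D ρ Tr F j (n + 1) := by
  rw [diffTrace, diffTrace, S.seqProd_sc_head (imgSeq D ρ F (n + 1)) n
    (a := diffSeq (imgSeq D ρ F) j (n + 1)), Tr.ev_sc_comm _ _ rfl, DGStr.seqProd]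
  · simp [diffSeq]
  · simp [diffSeq, imgSeq_lastFaceT_zero D ρ hF]
  · intro l h₁ h₂
    simp only [diffSeq, imgSeq_lastFaceT_of_pos D ρ F h₁ h₂]
    grind

theorem sum_alternating_telescope (P U V : ℕ → k) {j N : ℕ} (hj : 1 ≤ j) (hjN : j ≤ N)
    (h₀ : P 0 = U 1) (hU : ∀ i, 1 ≤ i → i < j → P i = U i + U (i + 1))
    (hj₁ : P j = U j) (hj₂ : P j = V (j + 1))
    (hV : ∀ i, j < i → i ≤ N → P i = V i + V (i + 1)) (hN : P (N + 1) = V (N + 1)) :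
    ∑ i ∈ Finset.range (N + 2), (-1 : k) ^ i * P i = (-1 : k) ^ (j - 1) * P j := by
  have first : ∀ m < j, ∑ i ∈ Finset.range (m + 1), (-1 : k) ^ i * P i =
      (-1 : k) ^ m * U (m + 1) := by
    intro m
    induction m with
    | zero => simp [h₀]
    | succ m ih =>
      intro hm
      rw [Finset.sum_range_succ, ih (by omega), hU (m + 1) (by omega) hm]
      ring
  have second : ∀ t, j + t ≤ N → ∑ i ∈ Finset.range (j + t + 1), (-1 : k) ^ i * P i =
      (-1 : k) ^ (j + 1) * V (j + 1) - (-1 : k) ^ (j + 1 + t) * V (j + 1 + t) := by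
    intro t
    induction t with
    | zero =>
      intro _
      obtain ⟨m, rfl⟩ : ∃ m, j = m + 1 := ⟨j - 1, by omega⟩
      rw [Nat.add_zero, Finset.sum_range_succ, first m (by omega), hj₁]
      ring
    | succ t ih =>
      intro ht
      rw [← Nat.add_assoc, Finset.sum_range_succ, ih (by omega),
        hV (j + t + 1) (by omega) (by omega), show j + 1 + (t + 1) = j + t + 1 + 1 by omega,
        show j + 1 + t = j + t + 1 by omega]
      ring
  have h := second (N - j) (by omega)
  rw [show j + (N - j) + 1 = N + 1 by omega, show j + 1 + (N - j) = N + 1 by omega] at h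
  rw [Finset.sum_range_succ, h, hN, hj₂]
  obtain ⟨m, rfl⟩ : ∃ m, j = m + 1 := ⟨j - 1, by omega⟩
  rw [Nat.add_sub_cancel]
  ring

/-- The periodicity operator applied to the character of a cycle is a Hochschild coboundary. -/
theorem sCharOp_eq_bOp_sPsi {F : D.Tup (r + 2)} (hF : D.IsCyc F) :
    sCharOp D Tr ρ F = D.bOp (sPsi D Tr ρ) F := by
  let P (j i : ℕ) : k := if i ≤ r + 1 then diffTrace D ρ Tr (D.faceT i F) j j
    else diffTrace D ρ Tr (D.lastFaceT F) j j
  have hb : D.bOp (sPsi D Tr ρ) F = ∑ i ∈ Finset.range (r + 3),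
      (-1 : k) ^ i * ∑ j ∈ Finset.Icc 1 (r + 1), (-1 : k) ^ (j - 1) * P j i := by
    rw [LinCat.bOp, ← Fin.sum_univ_eq_sum_range (fun i => (-1 : k) ^ i *
      ∑ j ∈ Finset.Icc 1 (r + 1), (-1 : k) ^ (j - 1) * P j i)]
    refine Finset.sum_congr rfl fun i _ => ?_
    by_cases hi : i.val ≤ r + 1 <;> simp [LinCat.deltaOp, P, hi, sPsi_eq_sum_diffTrace]
  rw [hb, sCharOp]
  simp_rw [Finset.mul_sum]
  rw [Finset.sum_comm]
  refine Finset.sum_congr rfl fun j hj => ?_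
  obtain ⟨hj, hjr⟩ := Finset.mem_Icc.mp hj
  have hP {i : ℕ} (hi : i ≤ r + 1) : P j i = diffTrace D ρ Tr (D.faceT i F) j j := if_pos hi
  have hPj : P j j = diffTrace D ρ Tr F j (j + 1) := by
    rw [hP hjr, diffTrace_faceT_self ρ Tr hF hjr]
  have h := sum_alternating_telescope (P j) (fun i => diffTrace D ρ Tr F i (j + 1))
    (fun i => diffTrace D ρ Tr F j i) hj hjr
    (by rw [hP (by omega), diffTrace_faceT_zero ρ Tr hF])
    (fun i h₁ h₂ => by
      rw [hP (by omega), diffTrace_faceT_leibniz ρ Tr hF h₁ (by omega) (Or.inl ⟨h₂, rfl⟩)])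
    hPj hPj
    (fun i h₁ h₂ => by
      rw [hP h₂, diffTrace_faceT_leibniz ρ Tr hF (by omega) h₂ (Or.inr ⟨h₁, rfl⟩),
        diffTrace_comm ρ Tr F i j, diffTrace_comm ρ Tr F (i + 1) j])
    (by
      simp only [P, if_neg (show ¬ r + 1 + 1 ≤ r + 1 by omega)]
      exact diffTrace_lastFaceT ρ Tr hF)
  simp_rw [mul_left_comm _ ((-1 : k) ^ (j - 1))]
  rw [← Finset.mul_sum, h, ← mul_assoc, ← pow_add, Even.neg_one_pow ⟨j - 1, rfl⟩, one_mul, hPj,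
    sCharTerm_eq_diffTrace D ρ Tr F hj hjr]

end Coboundary

/-- **Statement 14.**  Let `φ ∈ Z^r_λ(C)` be the character of an
`r`-dimensional cycle `(S, ∂̂, T̂, ρ)` over the small `ℂ`-linear category `C`.
Then `S(φ)` is a coboundary: explicitly `S(φ) = bψ` where
`ψ(f⁰ ⊗ … ⊗ f^{r+1}) = ∑_{j=1}^{r+1} (-1)^{j-1}
T̂(f⁰ ∂̂f¹ ⋯ ∂̂f^{j-1} · f^j · ∂̂f^{j+1} ⋯ ∂̂f^{r+1})` (writing `f` for `ρ(f)`),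
as functionals on the cyclic nerve. -/
theorem statement_14 (C : LinCat ℂ) (r : ℕ) (Obj' : Type) (S : DGStr ℂ Obj')
    (Tr : GrTrace S r) (ρ : SemiFun0 C.toSemiCat S) (φ : C.Tup r → ℂ)
    (hcocycle : C.IsCochain φ ∧
      (∀ F : C.Tup r, C.IsCyc F → C.lamOp φ F = φ F) ∧
      (∀ F : C.Tup (r + 1), C.IsCyc F → C.bOp φ F = 0))
    (hchar : IsCharOf C S Tr ρ φ) :
    ∀ F : C.Tup (r + 2), C.IsCyc F →
      sCharOp C Tr ρ F = C.bOp (sPsi C Tr ρ) F :=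
  fun _ hF => sCharOp_eq_bOp_sPsi ρ Tr hF
end

section
/- Let C be a small ℂ-linear category. Then the image of the operator B = AB₀ : CN^{n+1}(C) → CN^n(C) is exactly C^n_λ(C) = Ker(1−λ) ⊆ CN^n(C). -/
open scoped BigOperators TensorProduct

namespace LinCat

section CochainCalculus

variable {k : Type} [CommRing k] (D : LinCat k) {n : ℕ}

/-- A morphism `X → Y`, bundled. -/
def homM (X Y : D.Obj) (f : D.Hom X Y) : D.toSemiCat.M := ⟨X, Y, f⟩

/-- Replace the entry of a tuple at slot `i`. -/
def put (F : D.Tup n) (i : Fin (n + 1)) (x : D.toSemiCat.M) : D.Tup n := Function.update F i x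

/-- The tuple `(f¹, …, fⁿ⁺¹)` obtained by dropping the first entry. -/
def tailT (F : D.Tup (n + 1)) : D.Tup n := fun j => F j.succ

/-- The tuple `(f⁰, …, fⁿ)` obtained by dropping the last entry. -/
def initT (F : D.Tup (n + 1)) : D.Tup n := fun j => F j.castSucc

/-- A function of a single bundled morphism that is linear on every Hom-module. -/
def IsHomLinear (χ : D.toSemiCat.M → k) : Prop :=
  ∀ X Y, ∃ L : D.Hom X Y →ₗ[k] k, ∀ f, χ (D.homM X Y f) = L f

/-- A function on tuples that is linear in the slot `i`. -/
def IsSlotLinear (φ : D.Tup n → k) (i : Fin (n + 1)) : Prop :=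
  ∀ F : D.Tup n, D.IsHomLinear fun x => φ (D.put F i x)

variable {D}

theorem IsHomLinear.add {χ χ' : D.toSemiCat.M → k} (h : D.IsHomLinear χ)
    (h' : D.IsHomLinear χ') : D.IsHomLinear fun x => χ x + χ' x := by
  intro X Y
  obtain ⟨L, hL⟩ := h X Y
  obtain ⟨L', hL'⟩ := h' X Y
  exact ⟨L + L', fun f => by simp [hL, hL']⟩

theorem IsHomLinear.const_mul {χ : D.toSemiCat.M → k} (h : D.IsHomLinear χ) (c : k) :
    D.IsHomLinear fun x => c * χ x := by
  intro X Y
  obtain ⟨L, hL⟩ := h X Y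
  exact ⟨c • L, fun f => by simp [hL]⟩

theorem IsHomLinear.mul_const {χ : D.toSemiCat.M → k} (h : D.IsHomLinear χ) (c : k) :
    D.IsHomLinear fun x => χ x * c := by
  simpa only [mul_comm] using h.const_mul c

theorem IsHomLinear.sub {χ χ' : D.toSemiCat.M → k} (h : D.IsHomLinear χ)
    (h' : D.IsHomLinear χ') : D.IsHomLinear fun x => χ x - χ' x := by
  simpa [sub_eq_add_neg] using h.add (h'.const_mul (-1))

theorem IsHomLinear.apply_zero {χ : D.toSemiCat.M → k} (h : D.IsHomLinear χ) (X Y : D.Obj) :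
    χ (D.homM X Y 0) = 0 := by
  obtain ⟨L, hL⟩ := h X Y
  simp [hL]

@[simp]
theorem dom_homM {X Y : D.Obj} (f : D.Hom X Y) : D.dom (D.homM X Y f) = X := rfl

@[simp]
theorem cod_homM {X Y : D.Obj} (f : D.Hom X Y) : D.cod (D.homM X Y f) = Y := rfl

@[simp]
theorem dom_idM (X : D.Obj) : D.dom (D.idM X) = X := rfl

@[simp]
theorem cod_idM (X : D.Obj) : D.cod (D.idM X) = X := rfl

theorem idM_eq_homM (X : D.Obj) : D.idM X = D.homM X X (D.id X) := rfl

theorem homM_eq (x : D.toSemiCat.M) : D.homM (D.dom x) (D.cod x) x.2.2 = x := rfl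

variable (D) in
theorem hom_eq_zero_of_id_eq_zero {X Y : D.Obj} (h : D.id Y = 0) (f : D.Hom X Y) : f = 0 := by
  rw [← D.id_comp f, h, ← zero_smul k (0 : D.Hom Y Y), D.comp_smul_left, zero_smul]

theorem tup_ext {F G : D.Tup n} (h : ∀ j, F j = G j) : F = G := funext h

@[simp]
theorem put_self (F : D.Tup n) (i : Fin (n + 1)) (x : D.toSemiCat.M) : D.put F i x i = x :=
  Function.update_self ..

@[simp]
theorem put_of_ne (F : D.Tup n) {i j : Fin (n + 1)} (h : j ≠ i) (x : D.toSemiCat.M) :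
    D.put F i x j = F j :=
  Function.update_of_ne h ..

@[simp]
theorem put_put (F : D.Tup n) (i : Fin (n + 1)) (x y : D.toSemiCat.M) :
    D.put (D.put F i x) i y = D.put F i y :=
  Function.update_idem ..

@[simp]
theorem put_eq_self (F : D.Tup n) (i : Fin (n + 1)) : D.put F i (F i) = F :=
  Function.update_eq_self ..

theorem put_comm (F : D.Tup n) {i j : Fin (n + 1)} (h : i ≠ j) (x y : D.toSemiCat.M) :
    D.put (D.put F i x) j y = D.put (D.put F j y) i x :=
  Function.update_comm (β := fun _ => D.toSemiCat.M) h x y F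

@[simp]
theorem tailT_apply (F : D.Tup (n + 1)) (j : Fin (n + 1)) : D.tailT F j = F j.succ := rfl

@[simp]
theorem initT_apply (F : D.Tup (n + 1)) (j : Fin (n + 1)) : D.initT F j = F j.castSucc := rfl

theorem isCochain_iff {φ : D.Tup n → k} :
    D.IsCochain φ ↔ (∀ i, D.IsSlotLinear φ i) ∧ ∀ F, ¬ D.IsCyc F → φ F = 0 := by
  constructor
  · intro h
    refine ⟨fun i F X Y => ?_, h.supported⟩
    let G : D.Tup n := D.put F i (D.homM X Y 0)
    have hG : G i = (⟨X, Y, 0⟩ : Σ (A B : D.Obj), D.Hom A B) := put_self ..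
    have hadd := h.map_add G i
    have hsmul := h.map_smul G i
    unfold upd at hadd hsmul
    rw [hG] at hadd hsmul
    refine ⟨{ toFun := fun f => φ (D.put G i (D.homM X Y f))
              map_add' := hadd
              map_smul' := hsmul }, fun f => ?_⟩
    simp [G]
  · rintro ⟨h, hs⟩
    refine ⟨fun F i f g => ?_, fun F i c f => ?_, hs⟩
    · obtain ⟨L, hL⟩ := h i F (F i).1 (F i).2.1
      exact (hL (f + g)).trans ((L.map_add f g).trans (congrArg₂ _ (hL f) (hL g)).symm)
    · obtain ⟨L, hL⟩ := h i F (F i).1 (F i).2.1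
      exact (hL (c • f)).trans ((L.map_smul c f).trans (congrArg (c * ·) (hL f)).symm)

theorem IsCochain.isSlotLinear {φ : D.Tup n → k} (h : D.IsCochain φ) (i : Fin (n + 1)) :
    D.IsSlotLinear φ i :=
  (isCochain_iff.1 h).1 i

/-- Linearity in a slot is inherited along a map of tuples that moves slot `i` to slot `j` and
otherwise depends on slot `i` only through its endpoints. -/
theorem IsSlotLinear.comp {m : ℕ} {φ : D.Tup m → k} {i : Fin (n + 1)} {j : Fin (m + 1)}
    (h : D.IsSlotLinear φ j) (T : D.Tup n → D.Tup m)
    (hT : ∀ F X Y, ∃ G : D.Tup m, ∀ f : D.Hom X Y,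
      T (D.put F i (D.homM X Y f)) = D.put G j (D.homM X Y f)) :
    D.IsSlotLinear (fun F => φ (T F)) i := by
  intro F X Y
  obtain ⟨G, hG⟩ := hT F X Y
  obtain ⟨L, hL⟩ := h G X Y
  exact ⟨L, fun f => by simpa only [hG] using hL f⟩

theorem zero_sub_one_eq_last : (0 : Fin (n + 1)) - 1 = Fin.last n := by
  rw [sub_eq_iff_eq_add, Fin.last_add_one]

theorem isCyc_iff_forall {F : D.Tup n} :
    D.IsCyc F ↔ ∀ i, D.cod (F i) = D.dom (F (i - 1)) :=
  Iff.rfl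

theorem isCyc_iff {F : D.Tup n} :
    D.IsCyc F ↔ D.cod (F 0) = D.dom (F (Fin.last n)) ∧
      ∀ i : Fin n, D.cod (F i.succ) = D.dom (F i.castSucc) := by
  have hs : ∀ i : Fin n, i.succ - 1 = i.castSucc := fun i => by
    rw [sub_eq_iff_eq_add, Fin.coeSucc_eq_succ]
  simp only [isCyc_iff_forall, Fin.forall_fin_succ, zero_sub_one_eq_last, hs]

theorem rotT_apply (F : D.Tup n) (j : Fin (n + 1)) : D.rotT F j = F (j - 1) := by
  by_cases hj : j = 0
  · rw [hj, zero_sub_one_eq_last]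
    rfl
  · simp [rotT, hj]

@[simp]
theorem consIdT_zero (F : D.Tup n) : D.consIdT F 0 = D.idM (D.cod (F 0)) := rfl

@[simp]
theorem consIdT_succ (F : D.Tup n) (i : Fin (n + 1)) : D.consIdT F i.succ = F i := by
  simp [consIdT]

@[simp]
theorem snocIdT_castSucc (F : D.Tup n) (i : Fin (n + 1)) : D.snocIdT F i.castSucc = F i := by
  simp [snocIdT, Nat.le_of_lt_succ i.isLt]

@[simp]
theorem snocIdT_last (F : D.Tup n) :
    D.snocIdT F (Fin.last (n + 1)) = D.idM (D.cod (F 0)) := by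
  simp [snocIdT, SemiCat.cod]

theorem ofNat_succ_eq_add_one (m : ℕ) : Fin.ofNat (n + 1) (m + 1) = Fin.ofNat (n + 1) m + 1 := by
  ext
  simp [Fin.val_add]

theorem iterate_rotT_apply (F : D.Tup n) (m : ℕ) (j : Fin (n + 1)) :
    (D.rotT^[m] F) j = F (j - Fin.ofNat (n + 1) m) := by
  induction m generalizing j with
  | zero => simp
  | succ m ih => rw [Function.iterate_succ_apply', rotT_apply, ih, ofNat_succ_eq_add_one, sub_sub,
      add_comm (1 : Fin (n + 1))]

theorem iterate_rotT_self (F : D.Tup n) : D.rotT^[n + 1] F = F := by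
  funext j
  rw [iterate_rotT_apply]
  simp

theorem iterate_lamOp (φ : D.Tup n → k) (m : ℕ) (F : D.Tup n) :
    D.lamOp^[m] φ F = ((-1 : k) ^ n) ^ m * φ (D.rotT^[m] F) := by
  induction m generalizing F with
  | zero => simp
  | succ m ih =>
    rw [Function.iterate_succ_apply', lamOp, tauOp, ih, Function.iterate_succ_apply, pow_succ']
    ring

theorem iterate_lamOp_self (φ : D.Tup n → k) : D.lamOp^[n + 1] φ = φ := by
  funext F
  rw [iterate_lamOp, iterate_rotT_self, ← pow_mul, (Nat.even_mul_succ_self n).neg_one_pow, one_mul]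

theorem lamOp_const_mul (c : k) {φ : D.Tup n → k} (h : D.lamOp φ = φ) :
    D.lamOp (fun F => c * φ F) = fun F => c * φ F := by
  funext F
  rw [← congrFun h F]
  simp only [lamOp, tauOp]
  ring

theorem lamOp_AOp (φ : D.Tup n → k) : D.lamOp (D.AOp φ) = D.AOp φ := by
  funext F
  have h : D.lamOp (D.AOp φ) F = ∑ i ∈ Finset.range (n + 1), D.lamOp^[i + 1] φ F := by
    simp only [Function.iterate_succ_apply', lamOp, tauOp, AOp, Finset.mul_sum]
  rw [h, ← add_left_inj (D.lamOp^[0] φ F), ← Finset.sum_range_succ' (fun i => D.lamOp^[i] φ F),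
    Finset.sum_range_succ, iterate_lamOp_self]
  rfl

theorem isCyc_of_isCyc_rotT {F : D.Tup n} (h : D.IsCyc (D.rotT F)) : D.IsCyc F := by
  rw [isCyc_iff_forall] at h ⊢
  intro i
  simpa [rotT_apply] using h (i + 1)

theorem isCyc_consIdT_iff {F : D.Tup n} : D.IsCyc (D.consIdT F) ↔ D.IsCyc F := by
  simp only [isCyc_iff, ← Fin.succ_last, Fin.forall_fin_succ (n := n), consIdT_succ, consIdT_zero,
    Fin.castSucc_zero, ← Fin.succ_castSucc, cod_idM, dom_idM, true_and]

theorem isCyc_snocIdT_iff {F : D.Tup n} : D.IsCyc (D.snocIdT F) ↔ D.IsCyc F := by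
  have h0 : D.snocIdT F 0 = F 0 := snocIdT_castSucc F 0
  simp only [isCyc_iff, Fin.forall_fin_succ' (n := n), h0, snocIdT_last, snocIdT_castSucc,
    Fin.succ_last, Fin.succ_castSucc, cod_idM, dom_idM, true_and, and_comm]

theorem IsCochain.add {φ ψ : D.Tup n → k} (hφ : D.IsCochain φ) (hψ : D.IsCochain ψ) :
    D.IsCochain fun F => φ F + ψ F :=
  isCochain_iff.2 ⟨fun i F => (hφ.isSlotLinear i F).add (hψ.isSlotLinear i F),
    fun F hF => by simp [hφ.supported F hF, hψ.supported F hF]⟩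

theorem IsCochain.const_mul {φ : D.Tup n → k} (hφ : D.IsCochain φ) (c : k) :
    D.IsCochain fun F => c * φ F :=
  isCochain_iff.2 ⟨fun i F => (hφ.isSlotLinear i F).const_mul c,
    fun F hF => by simp [hφ.supported F hF]⟩

theorem IsCochain.sub {φ ψ : D.Tup n → k} (hφ : D.IsCochain φ) (hψ : D.IsCochain ψ) :
    D.IsCochain fun F => φ F - ψ F := by
  simpa [sub_eq_add_neg] using hφ.add (hψ.const_mul (-1))

theorem IsCochain.zero : D.IsCochain fun _ : D.Tup n => (0 : k) :=
  isCochain_iff.2 ⟨fun _ _ _ _ => ⟨0, fun _ => rfl⟩, fun _ _ => rfl⟩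

theorem IsCochain.sum {ι : Type} (s : Finset ι) {φ : ι → D.Tup n → k}
    (hφ : ∀ i, D.IsCochain (φ i)) : D.IsCochain fun F => ∑ i ∈ s, φ i F := by
  classical
  induction s using Finset.induction_on with
  | empty => simpa using IsCochain.zero
  | insert a s ha ih => simpa only [Finset.sum_insert ha] using (hφ a).add ih

theorem IsCochain.lamOp {φ : D.Tup n → k} (hφ : D.IsCochain φ) : D.IsCochain (D.lamOp φ) := by
  refine IsCochain.const_mul (φ := D.tauOp φ) (isCochain_iff.2 ⟨fun i => ?_, fun F hF => ?_⟩) _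
  · refine (hφ.isSlotLinear (i + 1)).comp D.rotT fun F X Y =>
      ⟨D.rotT F, fun f => tup_ext fun j => ?_⟩
    by_cases hj : j = i + 1
    · simp [hj, rotT_apply]
    · have hj' : j - 1 ≠ i := by rwa [ne_eq, sub_eq_iff_eq_add]
      simp [hj, hj', rotT_apply]
  · exact hφ.supported _ fun h => hF (isCyc_of_isCyc_rotT h)

theorem IsCochain.iterate_lamOp {φ : D.Tup n → k} (hφ : D.IsCochain φ) (m : ℕ) :
    D.IsCochain (D.lamOp^[m] φ) := by
  induction m with
  | zero => exact hφ
  | succ m ih => rw [Function.iterate_succ_apply']; exact ih.lamOp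

theorem IsCochain.AOp {φ : D.Tup n → k} (hφ : D.IsCochain φ) : D.IsCochain (D.AOp φ) :=
  IsCochain.sum _ hφ.iterate_lamOp

theorem cod_put_homM_zero (F : D.Tup n) (i : Fin (n + 1)) {X Y : D.Obj} (f g : D.Hom X Y) :
    D.cod (D.put F i (D.homM X Y f) 0) = D.cod (D.put F i (D.homM X Y g) 0) := by
  by_cases hi : 0 = i
  · subst hi
    simp
  · simp [hi]

theorem tailT_put_succ (F : D.Tup (n + 1)) (i : Fin (n + 1)) (x : D.toSemiCat.M) :
    D.tailT (D.put F i.succ x) = D.put (D.tailT F) i x := by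
  refine tup_ext fun j => ?_
  by_cases hj : j = i <;> simp [hj]

theorem initT_put_castSucc (F : D.Tup (n + 1)) (i : Fin (n + 1)) (x : D.toSemiCat.M) :
    D.initT (D.put F i.castSucc x) = D.put (D.initT F) i x := by
  refine tup_ext fun j => ?_
  by_cases hj : j = i <;> simp [hj]

theorem tailT_put_zero (F : D.Tup (n + 1)) (x : D.toSemiCat.M) :
    D.tailT (D.put F 0 x) = D.tailT F :=
  tup_ext fun j => by simp

theorem initT_put_last (F : D.Tup (n + 1)) (x : D.toSemiCat.M) :
    D.initT (D.put F (Fin.last (n + 1)) x) = D.initT F :=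
  tup_ext fun j => by simp [(Fin.castSucc_lt_last j).ne]

@[simp]
theorem tailT_consIdT (F : D.Tup n) : D.tailT (D.consIdT F) = F :=
  tup_ext fun j => by simp

@[simp]
theorem initT_snocIdT (F : D.Tup n) : D.initT (D.snocIdT F) = F :=
  tup_ext fun j => by simp

theorem IsCochain.B0Op {ψ : D.Tup (n + 1) → k} (hψ : D.IsCochain ψ) :
    D.IsCochain (D.B0Op ψ) := by
  refine IsCochain.sub (φ := fun F => ψ (D.consIdT F)) ?_
    (IsCochain.const_mul (φ := fun F => ψ (D.snocIdT F)) ?_ _)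
  · refine isCochain_iff.2 ⟨fun i => ?_, fun F hF => hψ.supported _ fun h =>
      hF (isCyc_consIdT_iff.1 h)⟩
    refine (hψ.isSlotLinear i.succ).comp D.consIdT fun F X Y =>
      ⟨D.consIdT (D.put F i (D.homM X Y 0)), fun f => tup_ext fun j => ?_⟩
    refine Fin.cases ?_ (fun j => ?_) j
    · rw [put_of_ne _ (Fin.succ_ne_zero i).symm, consIdT_zero, consIdT_zero,
        cod_put_homM_zero F i f 0]
    · by_cases hj : j = i <;> simp [hj]
  · refine isCochain_iff.2 ⟨fun i => ?_, fun F hF => hψ.supported _ fun h =>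
      hF (isCyc_snocIdT_iff.1 h)⟩
    refine (hψ.isSlotLinear i.castSucc).comp D.snocIdT fun F X Y =>
      ⟨D.snocIdT (D.put F i (D.homM X Y 0)), fun f => tup_ext fun j => ?_⟩
    refine Fin.lastCases ?_ (fun j => ?_) j
    · rw [put_of_ne _ (Fin.castSucc_lt_last i).ne', snocIdT_last, snocIdT_last,
        cod_put_homM_zero F i f 0]
    · by_cases hj : j = i <;> simp [hj]

theorem IsSlotLinear.head_mul_tailT {χ : D.toSemiCat.M → k} (hχ : D.IsHomLinear χ)
    {φ : D.Tup n → k} (hφ : ∀ i, D.IsSlotLinear φ i) (i : Fin (n + 2)) :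
    D.IsSlotLinear (fun F : D.Tup (n + 1) => χ (F 0) * φ (D.tailT F)) i := by
  intro F
  refine Fin.cases ?_ (fun i => ?_) i
  · simpa [tailT_put_zero] using hχ.mul_const (φ (D.tailT F))
  · simpa [tailT_put_succ, (Fin.succ_ne_zero i).symm] using
      (hφ i (D.tailT F)).const_mul (χ (F 0))

theorem IsSlotLinear.initT_mul_last {χ : D.toSemiCat.M → k} (hχ : D.IsHomLinear χ)
    {φ : D.Tup n → k} (hφ : ∀ i, D.IsSlotLinear φ i) (i : Fin (n + 2)) :
    D.IsSlotLinear (fun F : D.Tup (n + 1) => φ (D.initT F) * χ (F (Fin.last (n + 1)))) i := by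
  intro F
  refine Fin.lastCases ?_ (fun i => ?_) i
  · simpa [initT_put_last] using hχ.const_mul (φ (D.initT F))
  · simpa [initT_put_castSucc, (Fin.castSucc_lt_last i).ne'] using
      (hφ i (D.initT F)).mul_const (χ (F (Fin.last (n + 1))))

theorem IsSlotLinear.head_mul_put_idM {χ : D.toSemiCat.M → k} (hχ : D.IsHomLinear χ)
    {φ : D.Tup n → k} (hφ : ∀ i, D.IsSlotLinear φ i) (i : Fin (n + 1)) :
    D.IsSlotLinear (fun F : D.Tup n => χ (F 0) * φ (D.put F 0 (D.idM (D.cod (F 0))))) i := by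
  intro F
  by_cases hi : i = 0
  · subst hi
    intro X Y
    obtain ⟨L, hL⟩ := hχ.mul_const (φ (D.put F 0 (D.idM Y))) X Y
    exact ⟨L, fun f => by simpa using hL f⟩
  · simpa [Ne.symm hi, put_comm F hi] using
      (hφ i (D.put F 0 (D.idM (D.cod (F 0))))).const_mul (χ (F 0))

theorem isCyc_put_homM_iff (F : D.Tup n) (i : Fin (n + 1)) {X Y : D.Obj} (f g : D.Hom X Y) :
    D.IsCyc (D.put F i (D.homM X Y f)) ↔ D.IsCyc (D.put F i (D.homM X Y g)) := by
  have hcod : ∀ j, D.cod (D.put F i (D.homM X Y f) j) = D.cod (D.put F i (D.homM X Y g) j) :=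
    fun j => by by_cases hj : j = i <;> simp [hj]
  have hdom : ∀ j, D.dom (D.put F i (D.homM X Y f) j) = D.dom (D.put F i (D.homM X Y g) j) :=
    fun j => by by_cases hj : j = i <;> simp [hj]
  simp only [isCyc_iff_forall, hcod, hdom]

open Classical in
/-- A multilinear function becomes a cochain once it is cut off outside the cyclic tuples. -/
theorem isCochain_ite_isCyc {φ : D.Tup n → k} (hφ : ∀ i, D.IsSlotLinear φ i) :
    D.IsCochain fun F => if D.IsCyc F then φ F else 0 := by
  refine isCochain_iff.2 ⟨fun i F X Y => ?_, fun F hF => if_neg hF⟩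
  by_cases h : D.IsCyc (D.put F i (D.homM X Y 0))
  · obtain ⟨L, hL⟩ := hφ i F X Y
    exact ⟨L, fun f => (if_pos ((isCyc_put_homM_iff F i f 0).2 h)).trans (hL f)⟩
  · exact ⟨0, fun f => if_neg (mt (isCyc_put_homM_iff F i f 0).1 h)⟩

end CochainCalculus

section NormalizedFunctional

variable {K : Type} [Field K] (D : LinCat K) {n : ℕ}

/-- There is a function of single morphisms that is linear on Hom-spaces and equal to `1` on
nonzero identities. -/
theorem exists_isHomLinear_idM_eq_one :
    ∃ χ : D.toSemiCat.M → K, D.IsHomLinear χ ∧ ∀ X, D.id X ≠ 0 → χ (D.idM X) = 1 := by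
  classical
  have h : ∀ X, ∃ L : D.Hom X X →ₗ[K] K, D.id X ≠ 0 → L (D.id X) = 1 := by
    intro X
    by_cases hX : D.id X = 0
    · exact ⟨0, fun h => absurd hX h⟩
    · obtain ⟨L, hL⟩ : ∃ L : Module.Dual K (D.Hom X X), L (D.id X) ≠ 0 := by
        by_contra! hc
        exact hX ((Module.forall_dual_apply_eq_zero_iff K _).1 hc)
      exact ⟨(L (D.id X))⁻¹ • L, fun _ => by simp [hL]⟩
  choose L hL using h
  refine ⟨fun x => if h : D.dom x = D.cod x then
      L (D.cod x) (cast (congrArg (D.Hom · (D.cod x)) h) x.2.2)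
    else 0, ?_, ?_⟩
  · intro X Y
    by_cases h : X = Y
    · subst h
      exact ⟨L X, fun f => dif_pos rfl⟩
    · exact ⟨0, fun f => dif_neg h⟩
  · intro X hX
    exact (dif_pos rfl).trans (hL X hX)

variable {D}

/-- Twice a cyclic cochain lies in the image of `B₀`. -/
theorem exists_B0Op_eq_two_mul {φ : D.Tup n → K} (hφ : D.IsCochain φ) (hl : D.lamOp φ = φ) :
    ∃ ψ : D.Tup (n + 1) → K, D.IsCochain ψ ∧ D.B0Op ψ = fun F => 2 * φ F := by
  obtain ⟨χ, hχ, hχ1⟩ := D.exists_isHomLinear_idM_eq_one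
  have hs := hφ.isSlotLinear
  have hs' : ∀ i, D.IsSlotLinear
      (fun F => φ F - χ (F 0) * φ (D.put F 0 (D.idM (D.cod (F 0))))) i :=
    fun i F => (hs i F).sub (IsSlotLinear.head_mul_put_idM hχ hs i F)
  have hψ := isCochain_ite_isCyc (φ := fun F => χ (F 0) * φ (D.tailT F) + (-1) ^ n *
      ((φ (D.initT F) - χ (D.initT F 0) *
        φ (D.put (D.initT F) 0 (D.idM (D.cod (D.initT F 0))))) * χ (F (Fin.last (n + 1)))))
    fun i F => (IsSlotLinear.head_mul_tailT hχ hs i F).add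
      ((IsSlotLinear.initT_mul_last hχ hs' i F).const_mul ((-1) ^ n))
  refine ⟨_, hψ, ?_⟩
  funext F
  by_cases hF : D.IsCyc F
  swap
  · rw [hψ.B0Op.supported F hF, hφ.supported F hF, mul_zero]
  have hsign : ((-1 : K) ^ n) * (-1) ^ n = 1 := by
    rw [← mul_pow]
    simp
  have hrot : φ (D.tailT (D.snocIdT F)) =
      (-1) ^ n * φ (D.put F 0 (D.idM (D.cod (F 0)))) := by
    conv_lhs => rw [← hl]
    simp only [lamOp, tauOp]
    congr 2
    refine tup_ext fun j => ?_
    rw [rotT_apply, tailT_apply]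
    refine Fin.cases ?_ (fun j => ?_) j
    · rw [zero_sub_one_eq_last, Fin.succ_last, snocIdT_last, put_self]
    · have hj : j.succ - 1 = j.castSucc := by rw [sub_eq_iff_eq_add, Fin.coeSucc_eq_succ]
      rw [hj, Fin.succ_castSucc, snocIdT_castSucc, put_of_ne _ (Fin.succ_ne_zero j)]
  have hinit : D.initT (D.consIdT F) 0 = D.idM (D.cod (F 0)) := rfl
  have hput : D.put (D.initT (D.consIdT F)) 0 (D.idM (D.cod (F 0))) = D.initT (D.consIdT F) := by
    rw [← hinit, put_eq_self]
  have hsnoc : D.snocIdT F 0 = F 0 := snocIdT_castSucc F 0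
  simp only [B0Op, isCyc_consIdT_iff, isCyc_snocIdT_iff, hF, if_true, hrot, hsnoc, hput, hinit,
    consIdT_zero, cod_idM, tailT_consIdT, initT_snocIdT, snocIdT_last]
  by_cases h : D.id (D.cod (F 0)) = 0
  · have h1 : φ (D.put F 0 (D.idM (D.cod (F 0)))) = 0 := by
      rw [idM_eq_homM, h]
      exact (hφ.isSlotLinear 0 F).apply_zero _ _
    have h2 : φ (D.initT (D.consIdT F)) = 0 := by
      rw [← hput, idM_eq_homM, h]
      exact (hφ.isSlotLinear 0 _).apply_zero _ _
    have h3 : φ F = 0 := by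
      have h0 : D.homM (D.dom (F 0)) (D.cod (F 0)) 0 = F 0 :=
        (congrArg (D.homM _ _) (D.hom_eq_zero_of_id_eq_zero h _).symm).trans (homM_eq (F 0))
      rw [← put_eq_self F 0, ← h0]
      exact (hφ.isSlotLinear 0 _).apply_zero _ _
    simp [h1, h2, h3]
  · rw [hχ1 _ h, pow_succ]
    linear_combination (φ F) * hsign

end NormalizedFunctional

end LinCat

/-- **Statement 16.**  For a small `ℂ`-linear category `C`, the image of the
operator `B = A ∘ B₀ : CN^{n+1}(C) → CN^n(C)` is exactly the space
`C^n_λ(C) = Ker(1 - λ)` of cyclic cochains. -/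
theorem statement_16 (C : LinCat ℂ) (n : ℕ) :
    (∀ ψ : C.Tup (n + 1) → ℂ, C.IsCochain ψ →
      C.IsCochain (C.BOp ψ) ∧
      (∀ F : C.Tup n, C.IsCyc F → C.lamOp (C.BOp ψ) F = C.BOp ψ F)) ∧
    (∀ φ : C.Tup n → ℂ, C.IsCochain φ →
      (∀ F : C.Tup n, C.IsCyc F → C.lamOp φ F = φ F) →
      ∃ ψ : C.Tup (n + 1) → ℂ, C.IsCochain ψ ∧
        ∀ F : C.Tup n, C.IsCyc F → C.BOp ψ F = φ F) := by
  refine ⟨fun ψ hψ => ⟨hψ.B0Op.AOp, fun F _ => congrFun (LinCat.lamOp_AOp _) F⟩, fun φ hφ hl => ?_⟩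
  have hl' : C.lamOp φ = φ := by
    funext F
    by_cases hF : C.IsCyc F
    · exact hl F hF
    · rw [hφ.lamOp.supported F hF, hφ.supported F hF]
  let c : ℂ := (2 * ((n + 1 : ℕ) : ℂ))⁻¹
  have hlc := LinCat.lamOp_const_mul c hl'
  obtain ⟨ψ, hψ, hB⟩ := LinCat.exists_B0Op_eq_two_mul (hφ.const_mul c) hlc
  refine ⟨ψ, hψ, fun F _ => ?_⟩
  have hit : ∀ i, C.lamOp^[i] (C.B0Op ψ) F = 2 * (c * φ F) := fun i => by
    rw [Function.iterate_fixed (by rw [hB]; exact LinCat.lamOp_const_mul 2 hlc) i, hB]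
  have hn : ((n + 1 : ℕ) : ℂ) ≠ 0 := Nat.cast_ne_zero.2 n.succ_ne_zero
  simp only [LinCat.BOp, LinCat.AOp, hit, Finset.sum_const, Finset.card_range, nsmul_eq_mul, c]
  field_simp
end
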